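/- Let k ∈ {1,…,n−1}, E ⊂ ℝⁿ compact with diam(E) < R, h ≥ 0 with hR < k, and let Ψ(t) = Rt if k = 1, Ψ(t) = t²|log(R/t)| if k = 2, Ψ(t) = t² if k ≥ 3. Then there exists C = C(n,k,hR) > 0 such that the principal eigenvalue satisfies μ̄(F_k^-, E) ≥ C / H_Ψ(E); in particular μ̄(F_k^-, E) = +∞ if H_Ψ(E) = 0. -/

import Mathlib

open MeasureTheory ENNReal

/-- P_k^-(∇²φ)(x): the sum of the k smallest eigenvalues of the Hessian of φ at x,
via its min-max characterization as the infimum of the trace of the Hessian over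
k-dimensional subspaces (orthonormal k-tuples). -/
noncomputable def PkHess (n k : ℕ) (φ : EuclideanSpace ℝ (Fin n) → ℝ)
    (x : EuclideanSpace ℝ (Fin n)) : ℝ :=
  sInf {t : ℝ | ∃ e : Fin k → EuclideanSpace ℝ (Fin n), Orthonormal ℝ e ∧
    t = ∑ i, iteratedFDeriv ℝ 2 φ x ![e i, e i]}

/-- `F_k^-[w] + c·w ≥ 0` on Ω in the viscosity sense, where
F_k^-[w] = P_k^-(∇²w) − h|∇w|: every C² test function touching w from above at a point
of Ω satisfies the inequality there. -/
def ViscSubsol (n k : ℕ) (h c : ℝ) (Ω : Set (EuclideanSpace ℝ (Fin n)))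
    (w : EuclideanSpace ℝ (Fin n) → ℝ) : Prop :=
  ∀ x ∈ Ω, ∀ φ : EuclideanSpace ℝ (Fin n) → ℝ, ContDiff ℝ 2 φ → φ x = w x →
    (∀ᶠ y in nhds x, w y ≤ φ y) →
    0 ≤ PkHess n k φ x - h * ‖gradient φ x‖ + c * w x

/-- The principal eigenvalue μ̄(F_k^-, Ω) of an open set Ω: the supremum (in EReal) of
those c for which there is w ∈ USC(Ω̄), w < 0 on Ω̄, with F_k^-[w] + cw ≥ 0 on Ω
in the viscosity sense. -/
noncomputable def muBarOpen (n k : ℕ) (h : ℝ)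
    (Ω : Set (EuclideanSpace ℝ (Fin n))) : EReal :=
  sSup ((fun c : ℝ => (c : EReal)) '' {c : ℝ | ∃ w : EuclideanSpace ℝ (Fin n) → ℝ,
    UpperSemicontinuousOn w (closure Ω) ∧ (∀ x ∈ closure Ω, w x < 0) ∧
    ViscSubsol n k h c Ω w})

/-- μ̄(F_k^-, E) for a set E: the supremum of μ̄(F_k^-, Ω) over open Ω ⊇ E. -/
noncomputable def muBar (n k : ℕ) (h : ℝ)
    (E : Set (EuclideanSpace ℝ (Fin n))) : EReal :=
  sSup {m : EReal | ∃ Ω : Set (EuclideanSpace ℝ (Fin n)),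
    IsOpen Ω ∧ E ⊆ Ω ∧ m = muBarOpen n k h Ω}

/-- The generalized Hausdorff measure H_Ψ with gauge Ψ(t) = Rt if k = 1,
t²|log(R/t)| if k = 2, t² if k ≥ 3. -/
noncomputable def HPsi (n k : ℕ) (R : ℝ) : Measure (EuclideanSpace ℝ (Fin n)) :=
  Measure.mkMetric (fun r : ℝ≥0∞ => ENNReal.ofReal
    (if k = 1 then R * r.toReal
     else if k = 2 then r.toReal ^ 2 * |Real.log (R / r.toReal)|
     else r.toReal ^ 2))

open Set Filter Topology RealInnerProductSpace

/-- Second-order necessary condition for a local minimum on the line. -/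
theorem second_deriv_nonneg_of_isLocalMin {f f₁ : ℝ → ℝ} {f₂ : ℝ} {x : ℝ}
    (hmin : IsLocalMin f x) (h₁ : ∀ t, HasDerivAt f (f₁ t) t) (h₂ : HasDerivAt f₁ f₂ x) :
    0 ≤ f₂ := by
  by_contra! hneg
  have hd : deriv f = f₁ := funext fun t => (h₁ t).deriv
  have hmax : IsLocalMax f x := by
    refine isLocalMax_of_deriv_deriv_neg ?_ (hmin.deriv_eq_zero) (h₁ x).continuousAt
    rw [hd, h₂.deriv]
    exact hneg
  have hconst : f =ᶠ[𝓝 x] fun _ => f x := by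
    filter_upwards [hmin, hmax] with t h h' using le_antisymm h' h
  have hzero : f₁ =ᶠ[𝓝 x] fun _ => 0 := by
    have := hconst.deriv
    rw [hd] at this
    simpa using this
  have := hzero.deriv_eq
  rw [h₂.deriv, deriv_const] at this
  exact hneg.ne this

section RegNorm

variable {V : Type*} [NormedAddCommGroup V]

/-- The regularized distance `√(|y|² + ρ²)` to the origin. -/
noncomputable def regNorm (ρ : ℝ) (y : V) : ℝ := √(‖y‖ ^ 2 + ρ ^ 2)

theorem regNorm_sq (ρ : ℝ) (y : V) : regNorm ρ y ^ 2 = ‖y‖ ^ 2 + ρ ^ 2 :=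
  Real.sq_sqrt (by positivity)

theorem regNorm_nonneg (ρ : ℝ) (y : V) : 0 ≤ regNorm ρ y := Real.sqrt_nonneg _

theorem regNorm_pos {ρ : ℝ} (hρ : 0 < ρ) (y : V) : 0 < regNorm ρ y :=
  Real.sqrt_pos.2 (by positivity)

theorem norm_le_regNorm (ρ : ℝ) (y : V) : ‖y‖ ≤ regNorm ρ y :=
  Real.le_sqrt_of_sq_le (by nlinarith [sq_nonneg ρ])

theorem le_regNorm (ρ : ℝ) (y : V) : ρ ≤ regNorm ρ y :=
  Real.le_sqrt_of_sq_le (by nlinarith [sq_nonneg ‖y‖])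

theorem continuous_regNorm (ρ : ℝ) : Continuous (regNorm ρ : V → ℝ) := by
  unfold regNorm
  fun_prop

theorem regNorm_lt_of_norm_le {ρ R : ℝ} {y : V} (hρ : 0 < ρ) (hρR : ρ ≤ R) (hy : ‖y‖ ≤ R) :
    regNorm ρ y < 2 * R := by
  have := regNorm_sq ρ y
  nlinarith [norm_nonneg y, regNorm_nonneg ρ y]

end RegNorm

section Viscosity

variable {V : Type*} [NormedAddCommGroup V] [InnerProductSpace ℝ V]

theorem hasDerivAt_line (y e : V) (t : ℝ) :
    HasDerivAt (fun s : ℝ => y + s • e) e t := by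
  simpa using ((hasDerivAt_id t).smul_const e).const_add y

/-- A `C²` function touching `w` from above has, along every line, the same first derivative
as `w` and a second derivative at least as large. -/
theorem directional_derivs_of_touching {w φ : V → ℝ} {x e : V} (hφ : ContDiff ℝ 2 φ)
    (heq : φ x = w x) (hle : ∀ᶠ y in 𝓝 x, w y ≤ φ y) {w₁ : ℝ → ℝ} {w₂ : ℝ}
    (h₁ : ∀ t, HasDerivAt (fun s : ℝ => w (x + s • e)) (w₁ t) t) (h₂ : HasDerivAt w₁ w₂ 0) :
    fderiv ℝ φ x e = w₁ 0 ∧ w₂ ≤ iteratedFDeriv ℝ 2 φ x ![e, e] := by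
  have hline := hasDerivAt_line x e
  have hφ₁ : ∀ t : ℝ, HasDerivAt (fun s : ℝ => φ (x + s • e)) (fderiv ℝ φ (x + t • e) e) t :=
    fun t => ((hφ.differentiable (by norm_num)) _).hasFDerivAt.comp_hasDerivAt t (hline t)
  have hφ₂ : HasDerivAt (fun s : ℝ => fderiv ℝ φ (x + s • e) e)
      (fderiv ℝ (fderiv ℝ φ) x e e) 0 := by
    have hd : Differentiable ℝ (fderiv ℝ φ) :=
      (hφ.fderiv_right (m := 1) (by norm_num)).differentiable (by norm_num)
    have := (hd (x + (0 : ℝ) • e)).hasFDerivAt.comp_hasDerivAt (0 : ℝ) (hline 0)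
    simpa using this.clm_apply (hasDerivAt_const (0 : ℝ) e)
  have hmin : IsLocalMin (fun s : ℝ => φ (x + s • e) - w (x + s • e)) 0 := by
    have hc : Tendsto (fun s : ℝ => x + s • e) (𝓝 0) (𝓝 x) := by
      simpa using (hline 0).continuousAt.tendsto
    filter_upwards [hc.eventually hle] with s hs
    simp only [zero_smul, add_zero, heq, sub_self]
    linarith
  have hd₁ := fun t => (hφ₁ t).sub (h₁ t)
  have e1 := hmin.hasDerivAt_eq_zero (hd₁ 0)
  have e2 := second_deriv_nonneg_of_isLocalMin hmin hd₁ (hφ₂.sub h₂)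
  rw [iteratedFDeriv_two_apply]
  simp only [zero_smul, add_zero] at e1
  simp only [Matrix.cons_val_zero, Matrix.cons_val_one]
  exact ⟨by linarith, by linarith⟩

theorem hasDerivAt_regNorm_line {ρ : ℝ} (hρ : 0 < ρ) (y e : V) (t : ℝ) :
    HasDerivAt (fun s : ℝ => regNorm ρ (y + s • e))
      (⟪y + t • e, e⟫ / regNorm ρ (y + t • e)) t := by
  have h := (((hasDerivAt_line y e t).norm_sq).add_const (ρ ^ 2)).sqrt (by positivity)
  exact h.congr_deriv (mul_div_mul_left _ _ two_ne_zero)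

theorem hasDerivAt_profile_line {Γ : ℝ → ℝ} {h ρ : ℝ} {j : ℕ} (hρ : 0 < ρ)
    (hΓ : ∀ u, 0 < u → HasDerivAt Γ (Real.exp (h * u) / u ^ j) u) (y e : V) (t : ℝ) :
    HasDerivAt (fun s : ℝ => Γ (regNorm ρ (y + s • e)))
      (Real.exp (h * regNorm ρ (y + t • e)) / regNorm ρ (y + t • e) ^ (j + 1) *
        ⟪y + t • e, e⟫) t := by
  have hu := regNorm_pos hρ (y + t • e)
  refine ((hΓ _ hu).comp t (hasDerivAt_regNorm_line hρ y e t)).congr_deriv ?_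
  field_simp
  ring

theorem hasDerivAt_profile_line_two {h ρ : ℝ} {j : ℕ} (hρ : 0 < ρ) (y e : V) :
    HasDerivAt (fun t : ℝ => Real.exp (h * regNorm ρ (y + t • e)) /
        regNorm ρ (y + t • e) ^ (j + 1) * ⟪y + t • e, e⟫)
      (Real.exp (h * regNorm ρ y) / regNorm ρ y ^ (j + 1) *
        (‖e‖ ^ 2 + (h - (j + 1) / regNorm ρ y) * (⟪y, e⟫ ^ 2 / regNorm ρ y))) 0 := by
  have hu := regNorm_pos hρ y
  have hr := hasDerivAt_regNorm_line hρ y e 0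
  have hu' : regNorm ρ (y + (0 : ℝ) • e) ≠ 0 := (regNorm_pos hρ _).ne'
  have hb : HasDerivAt (fun t : ℝ => ⟪y + t • e, e⟫) (‖e‖ ^ 2) 0 := by
    have := (hasDerivAt_line y e 0).inner ℝ (hasDerivAt_const (0 : ℝ) e)
    simpa [real_inner_self_eq_norm_sq] using this
  refine (((hr.const_mul h).exp.div (hr.pow (j + 1)) (pow_ne_zero _ hu')).mul hb).congr_deriv ?_
  simp only [zero_smul, add_zero, Pi.pow_apply, Pi.div_apply, Nat.add_sub_cancel,
    Nat.cast_add, Nat.cast_one]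
  field_simp
  ring

/-- The pointwise inequality `P_k^- - h|∇| ≥ 0`, in quantitative form, for the radial profile
with derivative `exp (h u) / u ^ (k - 1)`. -/
theorem profile_operator_bound {ι : Type*} [Fintype ι] {h ρ : ℝ} (hρ : 0 < ρ) (hh : 0 ≤ h)
    (y : V) {e : ι → V} (he : Orthonormal ℝ e) (hy : h * ‖y‖ ≤ Fintype.card ι) :
    (Fintype.card ι - h * ‖y‖) * (ρ ^ 2 / regNorm ρ y ^ 2) ≤
      (∑ i, (‖e i‖ ^ 2 + (h - Fintype.card ι / regNorm ρ y) * (⟪y, e i⟫ ^ 2 / regNorm ρ y))) -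
        h * ‖y‖ := by
  have hu := regNorm_pos hρ y
  have hru := norm_le_regNorm ρ y
  have hsq := regNorm_sq ρ y
  have hS : ∑ i, ⟪y, e i⟫ ^ 2 ≤ ‖y‖ ^ 2 := by
    simpa [real_inner_comm] using he.sum_inner_products_le y (s := Finset.univ)
  have hS0 : 0 ≤ ∑ i, ⟪y, e i⟫ ^ 2 := Finset.sum_nonneg fun i _ => sq_nonneg _
  simp only [he.1, Finset.sum_add_distrib, ← Finset.mul_sum, ← Finset.sum_div]
  simp only [one_pow, Finset.sum_const, Finset.card_univ, nsmul_eq_mul, mul_one]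
  generalize ∑ i, ⟪y, e i⟫ ^ 2 = S at *
  generalize (Fintype.card ι : ℝ) = k at *
  generalize regNorm ρ y = u at *
  have key : 0 ≤ (k - h * ‖y‖) * ‖y‖ ^ 2 + (h * u - k) * S := by
    nlinarith [mul_nonneg (sub_nonneg.2 hy) (sub_nonneg.2 hS),
      mul_nonneg (mul_nonneg hh (sub_nonneg.2 hru)) hS0]
  have : k + (h - k / u) * (S / u) - h * ‖y‖ - (k - h * ‖y‖) * (ρ ^ 2 / u ^ 2) =
      ((k - h * ‖y‖) * ‖y‖ ^ 2 + (h * u - k) * S) / u ^ 2 := by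
    have : ρ ^ 2 = u ^ 2 - ‖y‖ ^ 2 := by linarith
    rw [this]
    field_simp
    ring
  have h2 := div_nonneg key (sq_nonneg u)
  linarith

end Viscosity

theorem exists_profile (h : ℝ) (j : ℕ) :
    ∃ Γ : ℝ → ℝ, ∀ u, 0 < u → HasDerivAt Γ (Real.exp (h * u) / u ^ j) u := by
  have hc : ContinuousOn (fun u : ℝ => Real.exp (h * u) / u ^ j) (Ioi 0) :=
    ContinuousOn.div (by fun_prop) (by fun_prop) fun u hu => pow_ne_zero _ (ne_of_gt hu)
  refine ⟨fun u => ∫ v in (1 : ℝ)..u, Real.exp (h * v) / v ^ j, fun u hu => ?_⟩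
  refine intervalIntegral.integral_hasDerivAt_right ?_
    (hc.stronglyMeasurableAtFilter isOpen_Ioi u hu) (hc.continuousAt (Ioi_mem_nhds hu))
  exact (hc.mono (ordConnected_Ioi.uIcc_subset (by simp) hu)).intervalIntegrable

theorem profile_lt {Γ : ℝ → ℝ} {h : ℝ} {j : ℕ}
    (hΓ : ∀ u, 0 < u → HasDerivAt Γ (Real.exp (h * u) / u ^ j) u) {u v : ℝ} (hu : 0 < u)
    (huv : u < v) : Γ u < Γ v := by
  refine strictMonoOn_of_deriv_pos (convex_Ioi (0 : ℝ))
    (fun x hx => (hΓ x hx).continuousAt.continuousWithinAt) (fun x hx => ?_) hu (hu.trans huv) huv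
  rw [interior_Ioi] at hx
  have hx' : 0 < x := hx
  rw [(hΓ x hx).deriv]
  positivity

theorem sub_le_sub_of_deriv_le {f g f' g' : ℝ → ℝ} {a b : ℝ} (hab : a ≤ b)
    (hf : ∀ x ∈ Icc a b, HasDerivAt f (f' x) x) (hg : ∀ x ∈ Icc a b, HasDerivAt g (g' x) x)
    (hle : ∀ x ∈ Icc a b, f' x ≤ g' x) : f b - f a ≤ g b - g a := by
  have hd : ∀ x ∈ Icc a b, HasDerivAt (fun x => g x - f x) (g' x - f' x) x :=
    fun x hx => (hg x hx).sub (hf x hx)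
  have := monotoneOn_of_deriv_nonneg (convex_Icc a b)
    (fun x hx => (hd x hx).continuousAt.continuousWithinAt)
    (fun x hx => (hd x (interior_subset hx)).differentiableAt.differentiableWithinAt)
    (fun x hx => by
      rw [(hd x (interior_subset hx)).deriv]
      exact sub_nonneg.2 (hle x (interior_subset hx)))
    (left_mem_Icc.2 hab) (right_mem_Icc.2 hab) hab
  simp only at this
  linarith

/-- The real-valued gauge `Ψ`. -/
noncomputable def gaugeFn (k : ℕ) (R t : ℝ) : ℝ :=
  if k = 1 then R * t else if k = 2 then t ^ 2 * |Real.log (R / t)| else t ^ 2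

theorem gaugeFn_continuous (k : ℕ) {R : ℝ} (hR : 0 < R) : Continuous (gaugeFn k R) := by
  unfold gaugeFn
  split_ifs
  · fun_prop
  · have : (fun t : ℝ => t ^ 2 * |Real.log (R / t)|) =
        fun t => |t * (t * Real.log R - t * Real.log t)| := by
      funext t
      rcases eq_or_ne t 0 with rfl | ht
      · simp
      · rw [Real.log_div hR.ne' ht, ← mul_sub, ← mul_assoc, abs_mul, ← sq,
          abs_of_nonneg (sq_nonneg t)]
    rw [this]
    exact (continuous_id.mul ((by fun_prop : Continuous fun t : ℝ => t * Real.log R).sub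
      Real.continuous_mul_log)).abs
  · fun_prop

theorem gaugeFn_nonneg (k : ℕ) {R t : ℝ} (hR : 0 < R) (ht : 0 ≤ t) : 0 ≤ gaugeFn k R t := by
  unfold gaugeFn
  split_ifs <;> positivity

/-- The total oscillation of the rescaled profile is controlled by the gauge. -/
theorem profile_osc_le {Γ : ℝ → ℝ} {h R ρ : ℝ} {j : ℕ} (hh : 0 ≤ h)
    (hΓ : ∀ u, 0 < u → HasDerivAt Γ (Real.exp (h * u) / u ^ j) u) (hρ : 0 < ρ)
    (hρR : ρ < R / 2) :
    ρ ^ (j + 1) * (Γ (2 * R) - Γ ρ) ≤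
      2 * Real.exp (2 * (h * R)) * gaugeFn (j + 1) R ρ := by
  have hR : 0 < R := by linarith
  have hle : ρ ≤ 2 * R := by linarith
  set M := Real.exp (2 * (h * R)) with hM
  have hM0 : 0 < M := Real.exp_pos _
  have hexp : ∀ x ∈ Icc ρ (2 * R), Real.exp (h * x) ≤ M := fun x hx =>
    Real.exp_le_exp.2 (by nlinarith [mul_le_mul_of_nonneg_left hx.2 hh])
  have hpos : ∀ x ∈ Icc ρ (2 * R), 0 < x := fun x hx => hρ.trans_le hx.1
  have hΓ' : ∀ x ∈ Icc ρ (2 * R), HasDerivAt Γ (Real.exp (h * x) / x ^ j) x :=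
    fun x hx => hΓ x (hpos x hx)
  match j with
  | 0 =>
    have := sub_le_sub_of_deriv_le (g := fun x => M * x) (g' := fun _ => M) hle hΓ'
      (fun x _ => by simpa using (hasDerivAt_id x).const_mul M)
      (fun x hx => by simpa using hexp x hx)
    simp only [gaugeFn, zero_add, pow_one, if_true]
    nlinarith [mul_le_mul_of_nonneg_left this hρ.le, mul_pos hM0 (mul_pos hρ hρ)]
  | 1 =>
    have := sub_le_sub_of_deriv_le (g := fun x => M * Real.log x) (g' := fun x => M * x⁻¹) hle hΓ'
      (fun x hx => (Real.hasDerivAt_log (hpos x hx).ne').const_mul M)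
      (fun x hx => by
        rw [pow_one, div_eq_mul_inv]
        exact mul_le_mul_of_nonneg_right (hexp x hx) (inv_nonneg.2 (hpos x hx).le))
    have hlog : 0 ≤ Real.log (R / ρ) := Real.log_nonneg (by rw [le_div_iff₀ hρ]; linarith)
    have h2 : Real.log (2 * R) - Real.log ρ ≤ 2 * Real.log (R / ρ) := by
      rw [← Real.log_div (by positivity) hρ.ne', two_mul (Real.log (R / ρ)),
        ← Real.log_mul (by positivity) (by positivity)]
      refine Real.log_le_log (by positivity) ?_
      rw [div_mul_div_comm, div_le_div_iff₀ hρ (by positivity)]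
      nlinarith [mul_pos hR hρ, mul_pos (mul_pos hR hρ) (sub_pos.2 hρR)]
    have h3 : Γ (2 * R) - Γ ρ ≤ M * (2 * Real.log (R / ρ)) := by
      refine this.trans ?_
      rw [← mul_sub]
      exact mul_le_mul_of_nonneg_left h2 hM0.le
    simp only [gaugeFn, Nat.reduceAdd, OfNat.ofNat_ne_one, if_false, if_true, abs_of_nonneg hlog]
    nlinarith [mul_le_mul_of_nonneg_left h3 (sq_nonneg ρ)]
  | i + 2 =>
    have := sub_le_sub_of_deriv_le (g := fun x => -(M / ρ ^ i) * x⁻¹)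
      (g' := fun x => -(M / ρ ^ i) * -(x ^ 2)⁻¹) hle hΓ'
      (fun x hx => (hasDerivAt_inv (hpos x hx).ne').const_mul _)
      (fun x hx => by
        have hx0 := hpos x hx
        rw [neg_mul_neg, ← div_eq_mul_inv, div_div, pow_add]
        exact div_le_div₀ hM0.le (hexp x hx) (by positivity)
          (mul_le_mul_of_nonneg_right (pow_le_pow_left₀ hρ.le hx.1 i) (by positivity)))
    have h3 : Γ (2 * R) - Γ ρ ≤ M / ρ ^ i * ρ⁻¹ := by
      have : 0 ≤ M / ρ ^ i * (2 * R)⁻¹ := by positivity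
      linarith
    have h4 := mul_le_mul_of_nonneg_left h3 (by positivity : 0 ≤ ρ ^ (i + 2 + 1))
    have h5 : ρ ^ (i + 2 + 1) * (M / ρ ^ i * ρ⁻¹) = M * ρ ^ 2 := by
      field_simp
      ring
    simp only [gaugeFn]
    rw [if_neg (by omega), if_neg (by omega)]
    nlinarith [mul_pos hM0 (pow_pos hρ 2)]

/-- A compact set of small gauge measure is covered by finitely many balls, centred at its
points, whose gauges have small sum. -/
theorem exists_finite_ball_cover {X : Type*} [MetricSpace X] [MeasurableSpace X] [BorelSpace X]
    [Nonempty X] {g : ℝ → ℝ} (hg : Continuous g) (hg0 : ∀ t, 0 ≤ t → 0 ≤ g t) {E : Set X}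
    (hE : IsCompact E) {δ A : ℝ} (hδ : 0 < δ)
    (hA : Measure.mkMetric (fun r : ℝ≥0∞ => ENNReal.ofReal (g r.toReal)) E < ENNReal.ofReal A) :
    ∃ (s : Finset ℕ) (c : ℕ → X) (ρ : ℕ → ℝ), (∀ i ∈ s, c i ∈ E ∧ 0 < ρ i ∧ ρ i < δ) ∧
      E ⊆ ⋃ i ∈ s, Metric.ball (c i) (ρ i) ∧ ∑ i ∈ s, g (ρ i) ≤ A := by
  rw [Measure.mkMetric_apply] at hA
  have h1 := (le_iSup₂ (f := fun (r : ℝ≥0∞) (_ : 0 < r) => ⨅ (t : ℕ → Set X),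
    ⨅ (_ : E ⊆ Set.iUnion t), ⨅ (_ : ∀ (n : ℕ), Metric.ediam (t n) ≤ r),
      ∑' (n : ℕ), ⨆ (_ : (t n).Nonempty), ENNReal.ofReal (g (Metric.ediam (t n)).toReal))
    (ENNReal.ofReal (δ / 2)) (ENNReal.ofReal_pos.2 (by positivity))).trans_lt hA
  simp only [iInf_lt_iff] at h1
  obtain ⟨t, hEt, hdiam, hsum⟩ := h1
  obtain ⟨ε, hε, hεsum⟩ := ENNReal.exists_pos_sum_of_countable
    (tsub_pos_of_lt hsum).ne' ℕ
  have hfin : ∀ n, Metric.ediam (t n) ≠ ∞ := fun n =>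
    ((hdiam n).trans_lt ENNReal.ofReal_lt_top).ne
  set d : ℕ → ℝ := fun n => (Metric.ediam (t n)).toReal with hd
  have hd0 : ∀ n, 0 ≤ d n := fun n => ENNReal.toReal_nonneg
  have hdδ : ∀ n, d n < δ := fun n => by
    have : d n ≤ δ / 2 := ENNReal.toReal_le_of_le_ofReal (by positivity) (hdiam n)
    linarith
  have hρ : ∀ n, ∃ ρ, d n < ρ ∧ ρ < δ ∧ g ρ < g (d n) + ε n := fun n => by
    have h2 : ∀ᶠ ρ in 𝓝[>] (d n), g ρ < g (d n) + ε n :=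
      (hg.continuousAt.eventually_lt continuousAt_const
        (by simpa using hε n)).filter_mono nhdsWithin_le_nhds
    obtain ⟨ρ, hρ1, hρ2⟩ := (h2.and (Ioo_mem_nhdsGT (hdδ n))).exists
    exact ⟨ρ, hρ2.1, hρ2.2, hρ1⟩
  choose ρ hρd hρδ hρg using hρ
  have hc : ∀ n, ∃ c, n ∈ {n | (t n ∩ E).Nonempty} → c ∈ t n ∩ E := fun n => by
    by_cases h : (t n ∩ E).Nonempty
    · exact ⟨h.some, fun _ => h.some_mem⟩
    · exact ⟨Classical.arbitrary X, fun h' => absurd h' h⟩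
  choose c hc using hc
  obtain ⟨b, hb, hbfin, hEb⟩ := hE.elim_finite_subcover_image
    (b := {n | (t n ∩ E).Nonempty}) (c := fun n => Metric.ball (c n) (ρ n))
    (fun _ _ => Metric.isOpen_ball) (fun x hx => by
      obtain ⟨n, hn⟩ := mem_iUnion.1 (hEt hx)
      have hnI : n ∈ {n | (t n ∩ E).Nonempty} := ⟨x, hn, hx⟩
      refine mem_iUnion₂.2 ⟨n, hnI, ?_⟩
      rw [Metric.mem_ball, dist_edist]
      exact (ENNReal.toReal_mono (hfin n) (Metric.edist_le_ediam_of_mem hn (hc n hnI).1)).trans_lt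
        (hρd n))
  refine ⟨hbfin.toFinset, c, ρ, fun i hi => ?_, by simpa using hEb, ?_⟩
  · exact ⟨(hc i (hb (by simpa using hi))).2, (hd0 i).trans_lt (hρd i), hρδ i⟩
  · have hApos : 0 < ENNReal.ofReal A := bot_le.trans_lt hsum
    rw [← ENNReal.ofReal_le_ofReal_iff (ENNReal.ofReal_pos.1 hApos).le,
      ENNReal.ofReal_sum_of_nonneg fun i _ => hg0 _ ((hd0 i).trans (hρd i).le)]
    calc ∑ i ∈ hbfin.toFinset, ENNReal.ofReal (g (ρ i))
        ≤ ∑ i ∈ hbfin.toFinset, ((⨆ (_ : (t i).Nonempty), ENNReal.ofReal (g (d i))) + ε i) := by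
          refine Finset.sum_le_sum fun i hi => ?_
          have hne : (t i).Nonempty := ⟨c i, (hc i (hb (by simpa using hi))).1⟩
          rw [ciSup_pos hne, ← ENNReal.ofReal_coe_nnreal (p := ε i),
            ← ENNReal.ofReal_add (hg0 _ (hd0 i)) (NNReal.coe_nonneg _)]
          exact ENNReal.ofReal_le_ofReal (hρg i).le
      _ ≤ ∑' i, ((⨆ (_ : (t i).Nonempty), ENNReal.ofReal (g (d i))) + ε i) :=
          ENNReal.sum_le_tsum _
      _ = _ := ENNReal.tsum_add
      _ ≤ ENNReal.ofReal A := by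
          refine (add_le_add le_rfl hεsum.le).trans ?_
          exact (add_tsub_cancel_of_le hsum.le).le

/-- The barrier attached to a finite family of balls: a sum of radial profiles. -/
noncomputable def barrier {n : ℕ} (j : ℕ) (Γ : ℝ → ℝ) (R : ℝ) (s : Finset ℕ)
    (c : ℕ → EuclideanSpace ℝ (Fin n)) (ρ : ℕ → ℝ) (x : EuclideanSpace ℝ (Fin n)) : ℝ :=
  ∑ i ∈ s, ρ i ^ (j + 1) * (Γ (regNorm (ρ i) (x - c i)) - Γ (2 * R))

theorem exists_orthonormal {n k : ℕ} (hkn : k ≤ n) :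
    ∃ e : Fin k → EuclideanSpace ℝ (Fin n), Orthonormal ℝ e :=
  ⟨fun i => EuclideanSpace.basisFun (Fin n) ℝ (Fin.castLE hkn i),
    (EuclideanSpace.basisFun (Fin n) ℝ).orthonormal.comp _ (Fin.castLE_injective hkn)⟩

theorem barrier_viscSubsol {n j : ℕ} (hkn : j + 1 ≤ n) {h R a : ℝ} (hh : 0 ≤ h)
    (hhR : h * R < (j + 1 : ℕ)) (ha : 0 ≤ a) {Γ : ℝ → ℝ}
    (hΓ : ∀ u, 0 < u → HasDerivAt Γ (Real.exp (h * u) / u ^ j) u)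
    {s : Finset ℕ} {c : ℕ → EuclideanSpace ℝ (Fin n)} {ρ : ℕ → ℝ}
    (hρ : ∀ i ∈ s, 0 < ρ i ∧ ρ i < R / 2) {Ω : Set (EuclideanSpace ℝ (Fin n))}
    (hΩ : ∀ x ∈ Ω, ∀ i ∈ s, ‖x - c i‖ ≤ R) (hcov : ∀ x ∈ Ω, ∃ i ∈ s, ‖x - c i‖ < ρ i)
    (hsum : a * (2 * Real.exp (2 * (h * R)) * ∑ i ∈ s, gaugeFn (j + 1) R (ρ i)) ≤
      ((j + 1 : ℕ) - h * R) / 2 ^ (j + 3)) :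
    ViscSubsol n (j + 1) h a Ω (barrier j Γ R s c ρ) := by
  intro x hx φ hφ heq hle
  set u : ℕ → ℝ := fun i => regNorm (ρ i) (x - c i) with hu
  set p : ℕ → ℝ := fun i => ρ i ^ (j + 1) * (Real.exp (h * u i) / u i ^ (j + 1)) with hp
  have hu0 : ∀ i ∈ s, 0 < u i := fun i hi => regNorm_pos (hρ i hi).1 _
  have hp0 : ∀ i ∈ s, 0 < p i := fun i hi => by
    have := hu0 i hi
    have := (hρ i hi).1
    positivity
  have hdir : ∀ e : EuclideanSpace ℝ (Fin n),
      fderiv ℝ φ x e = ∑ i ∈ s, p i * ⟪x - c i, e⟫ ∧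
      ∑ i ∈ s, p i * (‖e‖ ^ 2 + (h - (j + 1 : ℕ) / u i) * (⟪x - c i, e⟫ ^ 2 / u i)) ≤
        iteratedFDeriv ℝ 2 φ x ![e, e] := fun e => by
    have h₁ : ∀ t, HasDerivAt (fun t : ℝ => barrier j Γ R s c ρ (x + t • e)) _ t := fun t =>
      HasDerivAt.fun_sum fun i hi =>
        (((hasDerivAt_profile_line (hρ i hi).1 hΓ (x - c i) e t).congr_of_eventuallyEq
          (f₁ := fun t : ℝ => Γ (regNorm (ρ i) (x + t • e - c i)))
          (Eventually.of_forall fun t => by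
            simp only [add_sub_right_comm])).sub_const (Γ (2 * R))).const_mul (ρ i ^ (j + 1))
    have h₂ := HasDerivAt.fun_sum fun i hi =>
      (hasDerivAt_profile_line_two (h := h) (j := j) (hρ i hi).1 (x - c i) e).const_mul
        (ρ i ^ (j + 1))
    have := directional_derivs_of_touching hφ heq hle h₁ h₂
    simpa only [zero_smul, add_zero, ← mul_assoc, hp, hu, Nat.cast_add, Nat.cast_one] using this
  have hgrad : ‖gradient φ x‖ ≤ ∑ i ∈ s, p i * ‖x - c i‖ := by
    have : gradient φ x = ∑ i ∈ s, p i • (x - c i) := by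
      refine ext_inner_right ℝ fun e => ?_
      rw [inner_gradient_left, (hdir e).1, sum_inner]
      simp only [real_inner_smul_left]
    rw [this]
    refine (norm_sum_le _ _).trans_eq (Finset.sum_congr rfl fun i hi => ?_)
    rw [norm_smul, Real.norm_of_nonneg (hp0 i hi).le]
  have hhr : ∀ i ∈ s, h * ‖x - c i‖ ≤ h * R := fun i hi =>
    mul_le_mul_of_nonneg_left (hΩ x hx i hi) hh
  have hPk : ∑ i ∈ s, p i * (((j + 1 : ℕ) - h * ‖x - c i‖) * (ρ i ^ 2 / u i ^ 2) +
      h * ‖x - c i‖) ≤ PkHess n (j + 1) φ x := by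
    obtain ⟨e₀, he₀⟩ := exists_orthonormal hkn
    refine le_csInf ⟨_, e₀, he₀, rfl⟩ ?_
    rintro _ ⟨e, he, rfl⟩
    refine le_trans ?_ (Finset.sum_le_sum fun l _ => (hdir (e l)).2)
    rw [Finset.sum_comm]
    refine Finset.sum_le_sum fun i hi => ?_
    rw [← Finset.mul_sum]
    refine mul_le_mul_of_nonneg_left ?_ (hp0 i hi).le
    have := profile_operator_bound (hρ i hi).1 hh (x - c i) he
      (by rw [Fintype.card_fin]; exact (hhr i hi).trans hhR.le)
    rw [Fintype.card_fin] at this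
    linarith
  have hterm : ∀ i ∈ s, 0 ≤ p i * (((j + 1 : ℕ) - h * ‖x - c i‖) * (ρ i ^ 2 / u i ^ 2)) :=
    fun i hi => mul_nonneg (hp0 i hi).le (mul_nonneg (by linarith [hhr i hi]) (by positivity))
  have hmain : ((j + 1 : ℕ) - h * R) / 2 ^ (j + 3) ≤
      ∑ i ∈ s, p i * (((j + 1 : ℕ) - h * ‖x - c i‖) * (ρ i ^ 2 / u i ^ 2)) := by
    obtain ⟨i, hi, hxi⟩ := hcov x hx
    refine le_trans ?_ (Finset.single_le_sum hterm hi)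
    have hui := hu0 i hi
    have hρi := (hρ i hi).1
    have hu2 : u i ≤ 2 * ρ i := (regNorm_lt_of_norm_le hρi le_rfl hxi.le).le
    have hexp : 1 ≤ Real.exp (h * u i) := Real.one_le_exp (by positivity)
    have hratio : (1 / 2 : ℝ) ^ (j + 3) ≤ (ρ i / u i) ^ (j + 3) := by
      refine pow_le_pow_left₀ (by norm_num) ?_ _
      rw [div_le_div_iff₀ two_pos hui]
      linarith
    calc ((j + 1 : ℕ) - h * R) / 2 ^ (j + 3) = (1 / 2 : ℝ) ^ (j + 3) * ((j + 1 : ℕ) - h * R) := by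
          rw [one_div, inv_pow]
          ring
      _ ≤ (ρ i / u i) ^ (j + 3) * ((j + 1 : ℕ) - h * ‖x - c i‖) :=
          mul_le_mul hratio (by linarith [hhr i hi]) (by linarith) (by positivity)
      _ ≤ Real.exp (h * u i) * ((ρ i / u i) ^ (j + 3) * ((j + 1 : ℕ) - h * ‖x - c i‖)) :=
          le_mul_of_one_le_left (mul_nonneg (by positivity) (by linarith [hhr i hi])) hexp
      _ = _ := by
          simp only [hp, div_pow]
          field_simp
          ring
  have hw : -(2 * Real.exp (2 * (h * R)) * ∑ i ∈ s, gaugeFn (j + 1) R (ρ i)) ≤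
      barrier j Γ R s c ρ x := by
    rw [Finset.mul_sum, ← Finset.sum_neg_distrib]
    refine Finset.sum_le_sum fun i hi => ?_
    have hρi := (hρ i hi).1
    have h1 := profile_osc_le hh hΓ hρi (hρ i hi).2
    have h2 : Γ (ρ i) ≤ Γ (u i) := by
      rcases (le_regNorm (ρ i) (x - c i)).eq_or_lt with h3 | h3
      · exact (congrArg Γ h3).le
      · exact (profile_lt hΓ hρi h3).le
    nlinarith [mul_le_mul_of_nonneg_left h2 (pow_pos hρi (j + 1)).le]
  have h1 := mul_le_mul_of_nonneg_left hgrad hh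
  have h2 := mul_le_mul_of_nonneg_left hw ha
  have h3 : ∑ i ∈ s, p i * (((j + 1 : ℕ) - h * ‖x - c i‖) * (ρ i ^ 2 / u i ^ 2) +
      h * ‖x - c i‖) = ∑ i ∈ s, p i * (((j + 1 : ℕ) - h * ‖x - c i‖) * (ρ i ^ 2 / u i ^ 2)) +
        h * ∑ i ∈ s, p i * ‖x - c i‖ := by
    rw [Finset.mul_sum, ← Finset.sum_add_distrib]
    exact Finset.sum_congr rfl fun i _ => by ring
  linarith

/-- If the gauge measure of `E` is less than `A`, then every `a ≥ 0` with `a * A` at most an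
explicit constant is admissible for some neighbourhood of `E`. -/
theorem le_muBar_of_measure_lt {n j : ℕ} (hkn : j + 1 ≤ n) {h R a A : ℝ} (hh : 0 ≤ h)
    (hR : 0 < R) (hhR : h * R < (j + 1 : ℕ)) (ha : 0 ≤ a) {E : Set (EuclideanSpace ℝ (Fin n))}
    (hE : IsCompact E) (hdiam : Metric.diam E < R) (hA : HPsi n (j + 1) R E < ENNReal.ofReal A)
    (haA : a * (2 * Real.exp (2 * (h * R)) * A) ≤ ((j + 1 : ℕ) - h * R) / 2 ^ (j + 3)) :
    (a : EReal) ≤ muBar n (j + 1) h E := by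
  obtain ⟨Γ, hΓ⟩ := exists_profile h j
  obtain ⟨s, c, ρ, hs, hcov, hsum⟩ := exists_finite_ball_cover
    (gaugeFn_continuous (j + 1) hR) (fun t ht => gaugeFn_nonneg (j + 1) hR ht) hE
    (half_pos hR) hA
  set Ω := (⋃ i ∈ s, Metric.ball (c i) (ρ i)) ∩ Metric.thickening (R - Metric.diam E) E
  have hΩo : IsOpen Ω :=
    (isOpen_biUnion fun _ _ => Metric.isOpen_ball).inter Metric.isOpen_thickening
  have hEΩ : E ⊆ Ω := subset_inter hcov (Metric.self_subset_thickening (sub_pos.2 hdiam) E)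
  have hdist : ∀ x ∈ Ω, ∀ i ∈ s, ‖x - c i‖ ≤ R := fun x hx i hi => by
    obtain ⟨z, hz, hxz⟩ := Metric.mem_thickening_iff.1 hx.2
    have h1 := Metric.dist_le_diam_of_mem hE.isBounded hz (hs i hi).1
    have h2 := dist_triangle x z (c i)
    rw [← dist_eq_norm]
    linarith
  have hclos : ∀ x ∈ closure Ω, ∀ i ∈ s, ‖x - c i‖ ≤ R := fun x hx i hi =>
    closure_minimal (fun y hy => hdist y hy i hi)
      (isClosed_le (continuous_sub_right (c i)).norm continuous_const) hx
  have hmem : ∀ x ∈ Ω, ∃ i ∈ s, ‖x - c i‖ < ρ i := fun x hx => by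
    obtain ⟨i, hi, hxi⟩ := mem_iUnion₂.1 hx.1
    exact ⟨i, hi, by rwa [← dist_eq_norm]⟩
  refine le_trans ?_ (le_sSup ⟨Ω, hΩo, hEΩ, rfl⟩)
  refine le_sSup ⟨a, ⟨barrier j Γ R s c ρ, ?_, ?_, ?_⟩, rfl⟩
  · refine Continuous.upperSemicontinuous ?_ |>.upperSemicontinuousOn _
    refine continuous_finsetSum _ fun i hi => ?_
    have : Continuous fun x => Γ (regNorm (ρ i) (x - c i)) :=
      continuous_iff_continuousAt.2 fun x =>
        (hΓ _ (regNorm_pos (hs i hi).2.1 _)).continuousAt.comp_of_eq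
          ((continuous_regNorm (ρ i)).comp (continuous_sub_right (c i))).continuousAt rfl
    exact continuous_const.mul (this.sub continuous_const)
  · intro x hx
    obtain ⟨y, hy⟩ := closure_nonempty_iff.1 ⟨x, hx⟩
    obtain ⟨i₀, hi₀, _⟩ := hmem y hy
    refine Finset.sum_neg (fun i hi => ?_) ⟨i₀, hi₀⟩
    have hρi := (hs i hi).2.1
    refine mul_neg_of_pos_of_neg (pow_pos hρi _) (sub_neg.2 (profile_lt hΓ (regNorm_pos hρi _) ?_))
    exact regNorm_lt_of_norm_le hρi (by linarith [(hs i hi).2.2]) (hclos x hx i hi)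
  · refine barrier_viscSubsol hkn hh hhR ha hΓ (fun i hi => (hs i hi).2) hdist hmem ?_
    refine le_trans ?_ haA
    gcongr

/-- A negative constant shows that the principal eigenvalue is nonnegative. -/
theorem muBar_nonneg {n j : ℕ} (hkn : j + 1 ≤ n) {h : ℝ} (E : Set (EuclideanSpace ℝ (Fin n))) :
    0 ≤ muBar n (j + 1) h E := by
  refine le_trans ?_ (le_sSup ⟨univ, isOpen_univ, subset_univ E, rfl⟩)
  refine le_sSup ⟨0, ⟨fun _ => -1, ?_, fun _ _ => by norm_num, ?_⟩, rfl⟩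
  · exact continuous_const.upperSemicontinuous.upperSemicontinuousOn _
  · intro x _ φ hφ heq hle
    have hdir := fun e => directional_derivs_of_touching (e := e) hφ heq hle
      (fun t => hasDerivAt_const t (-1 : ℝ)) (hasDerivAt_const (0 : ℝ) (0 : ℝ))
    have hgrad : gradient φ x = 0 := ext_inner_right ℝ fun e => by
      rw [inner_gradient_left, (hdir e).1, inner_zero_left]
    have hPk : 0 ≤ PkHess n (j + 1) φ x := by
      obtain ⟨e₀, he₀⟩ := exists_orthonormal hkn
      refine le_csInf ⟨_, e₀, he₀, rfl⟩ ?_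
      rintro _ ⟨e, _, rfl⟩
      exact Finset.sum_nonneg fun l _ => (hdir (e l)).2
    simpa [hgrad] using hPk

/-- For k ∈ {1,…,n−1}, E ⊂ ℝⁿ compact with diam(E) < R, h ≥ 0 with
hR < k, there is C = C(n,k,hR) > 0 such that μ̄(F_k^-, E) ≥ C / H_Ψ(E); in
particular μ̄(F_k^-, E) = +∞ if H_Ψ(E) = 0. -/
theorem stmt18 (n k : ℕ) (hn : 2 ≤ n) (hk1 : 1 ≤ k) (hkn : k ≤ n - 1)
    (q : ℝ) (hq0 : 0 ≤ q) (hqk : q < k) :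
    ∃ C : ℝ, 0 < C ∧ ∀ (R h : ℝ) (E : Set (EuclideanSpace ℝ (Fin n))),
      0 < R → 0 ≤ h → h * R = q → IsCompact E → Metric.diam E < R →
      ((ENNReal.ofReal C / HPsi n k R E : ℝ≥0∞) : EReal) ≤ muBar n k h E := by
  obtain ⟨j, rfl⟩ : ∃ j, k = j + 1 := ⟨k - 1, by omega⟩
  have hkn' : j + 1 ≤ n := by omega
  have hqk' : 0 < ((j + 1 : ℕ) : ℝ) - q := sub_pos.2 hqk
  set C : ℝ := ((j + 1 : ℕ) - q) / 2 ^ (j + 3) / (2 * Real.exp (2 * q)) with hC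
  have hC0 : 0 < C := by positivity
  refine ⟨C, hC0, fun R h E hR hh hhR hE hdiam => ?_⟩
  refine EReal.ge_of_forall_gt_iff_ge.1 fun a ha => ?_
  rcases le_or_gt a 0 with ha0 | ha0
  · exact (EReal.coe_le_coe_iff.2 ha0).trans (muBar_nonneg hkn' E)
  have ha' : ENNReal.ofReal a < ENNReal.ofReal C / HPsi n (j + 1) R E := by
    rw [← EReal.coe_ennreal_lt_coe_ennreal_iff, EReal.coe_ennreal_ofReal, max_eq_left ha0.le]
    exact ha
  refine le_muBar_of_measure_lt (A := C / a) hkn' hh hR (hhR ▸ hqk) ha0.le hE hdiam ?_ ?_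
  · have hne : ENNReal.ofReal a ≠ 0 := (ENNReal.ofReal_pos.2 ha0).ne'
    rw [ENNReal.ofReal_div_of_pos ha0,
      ENNReal.lt_div_iff_mul_lt (Or.inl hne) (Or.inl ENNReal.ofReal_ne_top), mul_comm]
    exact ENNReal.mul_lt_of_lt_div ha'
  · rw [hhR]
    refine le_of_eq ?_
    rw [hC]
    field_simp
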